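/- arXiv:1709.07975 — 2 statements merged into one kernel-verified Lean document; each statement's English description precedes it below -/
import Mathlib

section
/- For vertices a and b of a finite simple graph X with adjacency matrix A, the walk modules ⟨e_a⟩_A and ⟨e_b⟩_A are equal if and only if a and b are parallel and have the same eigenvalue support. -/
open Matrix BigOperators

/-- A spectral decomposition of a real symmetric matrix `A`: the `θ r` are the distinct
eigenvalues and `E r` is the orthogonal projection onto the `θ r`-eigenspace. -/
structure IsSpectralDecomp {V : Type*} [Fintype V] [DecidableEq V] (A : Matrix V V ℝ)
    {m : ℕ} (θ : Fin m → ℝ) (E : Fin m → Matrix V V ℝ) : Prop where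
  theta_inj : Function.Injective θ
  symm : ∀ r, (E r)ᵀ = E r
  idem : ∀ r, E r * E r = E r
  mul_eq_zero : ∀ r s, r ≠ s → E r * E s = 0
  sum_eq_one : ∑ r, E r = 1
  eq_sum : A = ∑ r, θ r • E r
  ne_zero : ∀ r, E r ≠ 0

namespace IsSpectralDecomp

variable {V : Type*} [Fintype V] [DecidableEq V] {A : Matrix V V ℝ} {m : ℕ} {θ : Fin m → ℝ}
  {E : Fin m → Matrix V V ℝ}

theorem mul_eq_smul (h : IsSpectralDecomp A θ E) (r : Fin m) : A * E r = θ r • E r := by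
  rw [h.eq_sum, Finset.sum_mul, Finset.sum_eq_single r]
  · rw [smul_mul_assoc, h.idem]
  · intro s _ hs
    rw [smul_mul_assoc, h.mul_eq_zero s r hs, smul_zero]
  · simp

theorem pow_mul_eq_smul (h : IsSpectralDecomp A θ E) (k : ℕ) (r : Fin m) :
    A ^ k * E r = θ r ^ k • E r := by
  induction k with
  | zero => simp
  | succ k ih => rw [pow_succ, mul_assoc, h.mul_eq_smul, mul_smul_comm, ih, smul_smul, pow_succ']

theorem pow_eq_sum (h : IsSpectralDecomp A θ E) (k : ℕ) : A ^ k = ∑ r, θ r ^ k • E r := by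
  rw [← mul_one (A ^ k), ← h.sum_eq_one, Finset.mul_sum]
  exact Finset.sum_congr rfl fun r _ => h.pow_mul_eq_smul k r

theorem aeval_eq_sum (h : IsSpectralDecomp A θ E) (p : Polynomial ℝ) :
    Polynomial.aeval A p = ∑ r, p.eval (θ r) • E r := by
  rw [Polynomial.aeval_eq_sum_range]
  simp_rw [h.pow_eq_sum, Polynomial.eval_eq_sum_range, Finset.smul_sum, Finset.sum_smul, smul_smul]
  exact Finset.sum_comm

/-- Each spectral idempotent is a polynomial in the matrix. -/
theorem exists_aeval_eq (h : IsSpectralDecomp A θ E) (r : Fin m) :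
    ∃ p : Polynomial ℝ, Polynomial.aeval A p = E r := by
  refine ⟨Lagrange.basis Finset.univ θ r, ?_⟩
  rw [h.aeval_eq_sum, Finset.sum_eq_single r]
  · rw [Lagrange.eval_basis_self h.theta_inj.injOn (Finset.mem_univ r), one_smul]
  · intro s _ hs
    rw [Lagrange.eval_basis_of_ne hs.symm (Finset.mem_univ s), zero_smul]
  · simp

/-- The walk module of a vector is spanned by its spectral components. -/
theorem span_pow_mulVec (h : IsSpectralDecomp A θ E) (v : V → ℝ) :
    Submodule.span ℝ (Set.range fun k : ℕ => (A ^ k) *ᵥ v) =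
      Submodule.span ℝ (Set.range fun r => E r *ᵥ v) := by
  apply le_antisymm <;> rw [Submodule.span_le, Set.range_subset_iff]
  · intro k
    rw [h.pow_eq_sum, Matrix.sum_mulVec]
    refine Submodule.sum_mem _ fun r _ => ?_
    rw [Matrix.smul_mulVec]
    exact Submodule.smul_mem _ _ (Submodule.subset_span ⟨r, rfl⟩)
  · intro r
    obtain ⟨p, hp⟩ := h.exists_aeval_eq r
    rw [← hp, Polynomial.aeval_eq_sum_range, Matrix.sum_mulVec]
    refine Submodule.sum_mem _ fun k _ => ?_
    rw [Matrix.smul_mulVec]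
    exact Submodule.smul_mem _ _ (Submodule.subset_span ⟨k, rfl⟩)

theorem mulVec_mem_span_singleton (h : IsSpectralDecomp A θ E) {w x : V → ℝ}
    (hx : x ∈ Submodule.span ℝ (Set.range fun s => E s *ᵥ w)) (r : Fin m) :
    E r *ᵥ x ∈ Submodule.span ℝ {E r *ᵥ w} := by
  suffices hle : Submodule.span ℝ (Set.range fun s => E s *ᵥ w) ≤
      (Submodule.span ℝ {E r *ᵥ w}).comap (E r).mulVecLin from hle hx
  rw [Submodule.span_le, Set.range_subset_iff]
  intro s
  simp only [SetLike.mem_coe, Submodule.mem_comap, Matrix.mulVecLin_apply, Matrix.mulVec_mulVec]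
  rcases eq_or_ne r s with rfl | hrs
  · rw [h.idem]
    exact Submodule.mem_span_singleton_self _
  · rw [h.mul_eq_zero r s hrs, Matrix.zero_mulVec]
    exact Submodule.zero_mem _

/-- One walk module is contained in another iff every spectral component of the first generator
is a multiple of the corresponding component of the second. -/
theorem span_pow_mulVec_le_iff (h : IsSpectralDecomp A θ E) (v w : V → ℝ) :
    Submodule.span ℝ (Set.range fun k : ℕ => (A ^ k) *ᵥ v) ≤
        Submodule.span ℝ (Set.range fun k : ℕ => (A ^ k) *ᵥ w) ↔
      ∀ r, ∃ c : ℝ, E r *ᵥ v = c • (E r *ᵥ w) := by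
  rw [h.span_pow_mulVec, h.span_pow_mulVec, Submodule.span_le, Set.range_subset_iff]
  refine forall_congr' fun r => ⟨fun hr => ?_, ?_⟩
  · have hmem := h.mulVec_mem_span_singleton hr r
    rw [Matrix.mulVec_mulVec, h.idem] at hmem
    obtain ⟨c, hc⟩ := Submodule.mem_span_singleton.mp hmem
    exact ⟨c, hc.symm⟩
  · rintro ⟨c, hc⟩
    rw [hc]
    exact Submodule.smul_mem _ _ (Submodule.subset_span ⟨r, rfl⟩)

end IsSpectralDecomp

/-- If `x` is a multiple of `y` and vanishes only when `y` does, then `y` is a multiple of `x`. -/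
theorem exists_eq_smul_symm {K M : Type*} [DivisionRing K] [AddCommGroup M] [Module K M] {x y : M}
    (hxy : ∃ c : K, x = c • y) (h0 : x = 0 → y = 0) : ∃ c : K, y = c • x := by
  obtain ⟨c, rfl⟩ := hxy
  rcases eq_or_ne c 0 with rfl | hc
  · exact ⟨0, by rw [zero_smul, h0 (zero_smul K y)]⟩
  · exact ⟨c⁻¹, (inv_smul_smul₀ hc y).symm⟩

/-- The walk modules of two vertices are equal iff the vertices are parallel and
have the same eigenvalue support. -/
theorem walkModule_eq_iff_parallel_and_support {V : Type*} [Fintype V] [DecidableEq V]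
    (X : SimpleGraph V) [DecidableRel X.Adj] {m : ℕ} (θ : Fin m → ℝ)
    (E : Fin m → Matrix V V ℝ) (hdec : IsSpectralDecomp (X.adjMatrix ℝ) θ E) (a b : V) :
    Submodule.span ℝ (Set.range fun k : ℕ => (X.adjMatrix ℝ ^ k) *ᵥ Pi.single a 1) =
        Submodule.span ℝ (Set.range fun k : ℕ => (X.adjMatrix ℝ ^ k) *ᵥ Pi.single b 1) ↔
      ((∀ r,
          (∃ c : ℝ, E r *ᵥ Pi.single a 1 = c • (E r *ᵥ Pi.single b 1)) ∨
          (∃ c : ℝ, E r *ᵥ Pi.single b 1 = c • (E r *ᵥ Pi.single a 1))) ∧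
        ∀ r, E r *ᵥ Pi.single a 1 ≠ 0 ↔ E r *ᵥ Pi.single b 1 ≠ 0) := by
  rw [le_antisymm_iff, hdec.span_pow_mulVec_le_iff, hdec.span_pow_mulVec_le_iff]
  constructor
  · rintro ⟨hab, hba⟩
    refine ⟨fun r => Or.inl (hab r), fun r => not_congr ⟨fun h => ?_, fun h => ?_⟩⟩
    · obtain ⟨c, hc⟩ := hba r
      rw [hc, h, smul_zero]
    · obtain ⟨c, hc⟩ := hab r
      rw [hc, h, smul_zero]
  · rintro ⟨hpar, hsupp⟩
    have hzero r := not_iff_not.mp (hsupp r)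
    exact ⟨fun r => (hpar r).elim id fun h => exists_eq_smul_symm h (hzero r).mpr,
      fun r => (hpar r).elim (fun h => exists_eq_smul_symm h (hzero r).mp) id⟩
end

section
/- Vertices a and b of a finite simple graph X with adjacency matrix A are strongly cospectral if and only if there exists a polynomial p with rational coefficients such that the matrix Q = p(A) satisfies Q² = I and Q e_a = e_b. (Such a Q is automatically a symmetric orthogonal matrix commuting with A.) -/
open Matrix BigOperators

open Polynomial in
/-- Membership of `w` in the cyclic subspace generated by `v` descends along a field extension. -/
theorem exists_aeval_mulVec_eq_of_map {K L V : Type*} [Field K] [Field L] [Algebra K L]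
    [Fintype V] [DecidableEq V] (M : Matrix V V K) (v w : V → K) (q : L[X])
    (h : aeval (M.map (algebraMap K L)) q *ᵥ (algebraMap K L ∘ v) = algebraMap K L ∘ w) :
    ∃ f : K[X], aeval M f *ᵥ v = w := by
  let krylov : K[X] →ₗ[K] V → K :=
    ((Matrix.mulVecBilin K K).flip v).comp (aeval M).toLinearMap
  have krylov_apply (f : K[X]) : krylov f = aeval M f *ᵥ v := rfl
  by_contra! hne
  have hw : w ∉ LinearMap.range krylov := by
    rintro ⟨f, hf⟩
    exact hne f hf
  obtain ⟨φ, hφw, hφ⟩ := Submodule.exists_le_ker_of_notMem hw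
  let c : V → K := fun j => φ (Pi.single j 1)
  have hc (x : V → K) : φ x = c ⬝ᵥ x := by
    conv_lhs => rw [LinearMap.pi_apply_eq_sum_univ φ x]
    simp only [dotProduct, smul_eq_mul, c]
    refine Finset.sum_congr rfl fun j _ => ?_
    rw [mul_comm]
    congr 2
    ext k
    simp [Pi.single_apply, eq_comm]
  have hpow (n : ℕ) : c ⬝ᵥ (M ^ n *ᵥ v) = 0 := by
    rw [← hc]
    have := hφ ⟨X ^ n, rfl⟩
    simpa [krylov_apply] using this
  have hdot (x : V → K) :
      (algebraMap K L ∘ c) ⬝ᵥ (algebraMap K L ∘ x) = algebraMap K L (c ⬝ᵥ x) :=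
    ((algebraMap K L).map_dotProduct c x).symm
  have hall (q : L[X]) :
      (algebraMap K L ∘ c) ⬝ᵥ
        (aeval (M.map (algebraMap K L)) q *ᵥ (algebraMap K L ∘ v)) = 0 := by
    induction q using Polynomial.induction_on' with
    | add p q hp hq => rw [map_add, add_mulVec, dotProduct_add, hp, hq, add_zero]
    | monomial n t =>
      have hmul : M.map (algebraMap K L) ^ n *ᵥ (algebraMap K L ∘ v) =
          algebraMap K L ∘ (M ^ n *ᵥ v) := by
        rw [← Matrix.map_pow]
        ext i
        exact ((algebraMap K L).map_mulVec (M ^ n) v i).symm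
      rw [aeval_monomial, ← Algebra.smul_def, smul_mulVec, hmul, dotProduct_smul, hdot, hpow]
      simp
  have := hall q
  rw [h, hdot, ← hc, map_eq_zero] at this
  exact hφw this

open Polynomial in
/-- If `ψ` is squarefree, then any `f` is congruent modulo `gcd (f ^ 2 - 1) ψ` to a
square root of `1` modulo `ψ`. -/
theorem exists_dvd_sq_sub_one_of_squarefree {K : Type*} [Field K] {ψ : K[X]}
    (hψ : Squarefree ψ) (f : K[X]) :
    ∃ p u v : K[X], ψ ∣ p ^ 2 - 1 ∧ p - f = u * (f ^ 2 - 1) + v * ψ := by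
  classical
  obtain ⟨g, hg⟩ := EuclideanDomain.gcd_dvd_right (f ^ 2 - 1) ψ
  set d := EuclideanDomain.gcd (f ^ 2 - 1) ψ with hd
  have hcop : IsCoprime d g := by
    rw [hg] at hψ
    exact (squarefree_mul_iff.1 hψ).1.isCoprime
  obtain ⟨s, t, hst⟩ := hcop
  have hbez := EuclideanDomain.gcd_eq_gcd_ab (f ^ 2 - 1) ψ
  rw [← hd] at hbez
  obtain ⟨k, hk⟩ := EuclideanDomain.gcd_dvd_left (f ^ 2 - 1) ψ
  rw [← hd] at hk
  refine ⟨f + s * d * (1 - f), s * (1 - f) * EuclideanDomain.gcdA (f ^ 2 - 1) ψ,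
    s * (1 - f) * EuclideanDomain.gcdB (f ^ 2 - 1) ψ, ?_, ?_⟩
  · rw [hg]
    refine IsCoprime.mul_dvd ⟨s, t, hst⟩ ?_ ?_
    · refine ⟨k + s * (1 - f) * (2 * f + s * d * (1 - f)), ?_⟩
      linear_combination hk
    · refine ⟨-(t * (1 - f)) * (2 - t * g * (1 - f)), ?_⟩
      have hsd : s * d = 1 - t * g := by linear_combination hst
      rw [hsd]
      ring
  · linear_combination s * (1 - f) * hbez

open Polynomial in
theorem Matrix.IsSymm.aeval {R S V : Type*} [CommSemiring R] [CommSemiring S] [Algebra R S]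
    [Fintype V] [DecidableEq V] {A : Matrix V V S} (hA : A.IsSymm) (p : R[X]) :
    (Polynomial.aeval A p).IsSymm := by
  induction p using Polynomial.induction_on' with
  | add p q hp hq => rw [map_add]; exact hp.add hq
  | monomial n t =>
    rw [aeval_monomial, ← Algebra.smul_def]
    exact (hA.pow n).smul t

open Polynomial in
theorem Matrix.IsSymm.squarefree_minpoly {V : Type*} [Fintype V] [DecidableEq V]
    {A : Matrix V V ℝ} (hA : A.IsSymm) (hA_int : IsIntegral ℚ A) : Squarefree (minpoly ℚ A) := by
  rintro u ⟨w, hw⟩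
  have hu : u ≠ 0 := by
    rintro rfl
    exact minpoly.ne_zero hA_int (by simpa using hw)
  have hw0 : w ≠ 0 := by
    rintro rfl
    exact minpoly.ne_zero hA_int (by simpa using hw)
  have hsq : Polynomial.aeval A (u * w) * Polynomial.aeval A (u * w) = 0 := by
    rw [← map_mul, show u * w * (u * w) = minpoly ℚ A * w by rw [hw]; ring, map_mul,
      minpoly.aeval, zero_mul]
  have hzero : Polynomial.aeval A (u * w) = 0 := by
    rw [← Matrix.conjTranspose_mul_self_eq_zero, conjTranspose_eq_transpose_of_trivial,
      (hA.aeval (u * w)).eq, hsq]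
  obtain ⟨k, hk⟩ := minpoly.dvd ℚ A hzero
  refine IsUnit.of_mul_eq_one k (mul_right_cancel₀ (mul_ne_zero hu hw0) ?_)
  rw [one_mul]
  linear_combination -hk - k * hw

namespace IsSpectralDecomp

open Polynomial

variable {V : Type*} [Fintype V] [DecidableEq V] {A : Matrix V V ℝ} {m : ℕ} {θ : Fin m → ℝ}
  {E : Fin m → Matrix V V ℝ}

theorem proj_mul_self (h : IsSpectralDecomp A θ E) (r : Fin m) : E r * A = θ r • E r := by
  conv_lhs => rw [h.eq_sum]
  rw [Finset.mul_sum, Finset.sum_eq_single r, mul_smul_comm, h.idem]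
  · intro s _ hs
    rw [mul_smul_comm, h.mul_eq_zero r s hs.symm, smul_zero]
  · simp

theorem proj_mul_aeval (h : IsSpectralDecomp A θ E) (q : ℝ[X]) (r : Fin m) :
    E r * aeval A q = q.eval (θ r) • E r := by
  have hpow (n : ℕ) : E r * A ^ n = θ r ^ n • E r := by
    induction n with
    | zero => simp
    | succ n ih => rw [pow_succ, ← mul_assoc, ih, smul_mul_assoc, h.proj_mul_self, smul_smul,
        ← pow_succ]
  induction q using Polynomial.induction_on' with
  | add p q hp hq => rw [map_add, mul_add, hp, hq, eval_add, add_smul]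
  | monomial n t =>
    rw [aeval_monomial, ← Algebra.smul_def, mul_smul_comm, hpow, smul_smul, eval_monomial]

theorem vec_ext (h : IsSpectralDecomp A θ E) {x y : V → ℝ}
    (hxy : ∀ r, E r *ᵥ x = E r *ᵥ y) : x = y := by
  rw [← one_mulVec x, ← one_mulVec y, ← h.sum_eq_one, sum_mulVec, sum_mulVec]
  exact Finset.sum_congr rfl fun r _ => hxy r

theorem proj_mulVec_aeval_mulVec (h : IsSpectralDecomp A θ E) (q : ℝ[X]) (r : Fin m)
    (x : V → ℝ) : E r *ᵥ (aeval A q *ᵥ x) = q.eval (θ r) • E r *ᵥ x := by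
  rw [mulVec_mulVec, h.proj_mul_aeval, smul_mulVec]

/-- Vectors whose projections agree up to sign are related by a real polynomial in `A`. -/
theorem exists_aeval_mulVec_eq (h : IsSpectralDecomp A θ E) {x y : V → ℝ}
    (hxy : ∀ r, E r *ᵥ x = E r *ᵥ y ∨ E r *ᵥ x = -(E r *ᵥ y)) :
    ∃ q : ℝ[X], aeval A q *ᵥ x = y := by
  classical
  let ε : Fin m → ℝ := fun r => if E r *ᵥ x = E r *ᵥ y then 1 else -1
  refine ⟨Lagrange.interpolate Finset.univ θ ε, h.vec_ext fun r => ?_⟩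
  rw [h.proj_mulVec_aeval_mulVec,
    Lagrange.eval_interpolate_at_node ε h.theta_inj.injOn (Finset.mem_univ r)]
  by_cases hr : E r *ᵥ x = E r *ᵥ y
  · simp [ε, hr]
  · rw [show ε r = -1 from if_neg hr, (hxy r).resolve_left hr, neg_one_smul, neg_neg]

/-- If the projections of `x` and `y` agree up to sign, a polynomial in `A` mapping `x` to `y`
also maps `y` to `x`. -/
theorem aeval_mulVec_symm (h : IsSpectralDecomp A θ E) {x y : V → ℝ}
    (hxy : ∀ r, E r *ᵥ x = E r *ᵥ y ∨ E r *ᵥ x = -(E r *ᵥ y)) {q : ℝ[X]}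
    (hq : aeval A q *ᵥ x = y) : aeval A q *ᵥ y = x := by
  refine h.vec_ext fun r => ?_
  have hr := h.proj_mulVec_aeval_mulVec q r x
  rw [hq] at hr
  rw [h.proj_mulVec_aeval_mulVec]
  rcases hxy r with hs | hs
  · rw [← hs, ← hr, hs]
  · rw [hs, smul_neg] at hr
    rw [hs, hr, neg_neg, ← hr]

theorem eval_eq_one_or_neg_one (h : IsSpectralDecomp A θ E) {q : ℝ[X]}
    (hq : aeval A q * aeval A q = 1) (r : Fin m) : q.eval (θ r) = 1 ∨ q.eval (θ r) = -1 := by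
  have hr := h.proj_mul_aeval (q * q) r
  rw [map_mul, hq, mul_one, eval_mul] at hr
  rw [← mul_self_eq_one_iff]
  exact smul_left_injective ℝ (h.ne_zero r) (by simpa using hr.symm)

end IsSpectralDecomp

/-- Vertices `a` and `b` are strongly cospectral iff there is a rational polynomial `p`
such that `Q = p(A)` satisfies `Q² = I` and `Q e_a = e_b`. -/
theorem stronglyCospectral_iff_exists_rational_polynomial {V : Type*} [Fintype V]
    [DecidableEq V] (X : SimpleGraph V) [DecidableRel X.Adj] {m : ℕ} (θ : Fin m → ℝ)
    (E : Fin m → Matrix V V ℝ) (hdec : IsSpectralDecomp (X.adjMatrix ℝ) θ E) (a b : V) :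
    (∀ r, E r *ᵥ Pi.single a 1 = E r *ᵥ Pi.single b 1 ∨
        E r *ᵥ Pi.single a 1 = -(E r *ᵥ Pi.single b 1)) ↔
      ∃ p : Polynomial ℚ,
        Polynomial.aeval (X.adjMatrix ℝ) (p.map (algebraMap ℚ ℝ)) *
            Polynomial.aeval (X.adjMatrix ℝ) (p.map (algebraMap ℚ ℝ)) = 1 ∧
          Polynomial.aeval (X.adjMatrix ℝ) (p.map (algebraMap ℚ ℝ)) *ᵥ Pi.single a 1 =
            Pi.single b 1 := by
  have hmap : X.adjMatrix ℝ = (X.adjMatrix ℚ).map (algebraMap ℚ ℝ) := by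
    ext i j
    simp [SimpleGraph.adjMatrix_apply, apply_ite]
  have hA_int : IsIntegral ℚ (X.adjMatrix ℝ) := by
    rw [hmap]
    exact (Matrix.isIntegral (X.adjMatrix ℚ)).map (algebraMap ℚ ℝ).toRatAlgHom.mapMatrix
  constructor
  · intro hab
    obtain ⟨q, hq⟩ := hdec.exists_aeval_mulVec_eq hab
    have hsingle (c : V) : (Pi.single c 1 : V → ℝ) = algebraMap ℚ ℝ ∘ Pi.single c 1 := by
      ext i
      by_cases hi : i = c <;> simp [hi]
    have hcast (f : Polynomial ℚ) (x : V → ℚ) :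
        Polynomial.aeval (X.adjMatrix ℝ) f *ᵥ (algebraMap ℚ ℝ ∘ x) =
          algebraMap ℚ ℝ ∘ (Polynomial.aeval (X.adjMatrix ℚ) f *ᵥ x) := by
      have hf : Polynomial.aeval (X.adjMatrix ℝ) f =
          (Polynomial.aeval (X.adjMatrix ℚ) f).map (algebraMap ℚ ℝ) := by
        rw [hmap]
        exact Polynomial.aeval_algHom_apply (algebraMap ℚ ℝ).toRatAlgHom.mapMatrix
          (X.adjMatrix ℚ) f
      rw [hf]
      ext i
      exact ((algebraMap ℚ ℝ).map_mulVec _ x i).symm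
    obtain ⟨f, hf⟩ := exists_aeval_mulVec_eq_of_map (X.adjMatrix ℚ) (Pi.single a 1)
      (Pi.single b 1) q (by rw [← hmap, ← hsingle, ← hsingle, hq])
    have hfab : Polynomial.aeval (X.adjMatrix ℝ) f *ᵥ Pi.single a 1 = Pi.single b 1 := by
      rw [hsingle, hcast, hf, ← hsingle]
    have hfba : Polynomial.aeval (X.adjMatrix ℝ) f *ᵥ Pi.single b 1 = Pi.single a 1 := by
      rw [← Polynomial.aeval_map_algebraMap ℝ] at hfab ⊢
      exact hdec.aeval_mulVec_symm hab hfab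
    obtain ⟨p, u, v, hp, hpf⟩ := exists_dvd_sq_sub_one_of_squarefree
      ((X.isSymm_adjMatrix (α := ℝ)).squarefree_minpoly hA_int) f
    refine ⟨p, ?_, ?_⟩ <;> rw [Polynomial.aeval_map_algebraMap]
    · have := (minpoly.dvd_iff).1 hp
      rwa [map_sub, map_one, sub_eq_zero, pow_two, map_mul] at this
    · rw [← hfab, ← sub_eq_zero, ← sub_mulVec, ← map_sub, hpf]
      simp only [map_add, map_mul, map_sub, map_one, map_pow, minpoly.aeval, mul_zero, add_zero]
      rw [← mulVec_mulVec, sub_mulVec, pow_two, ← mulVec_mulVec, hfab, hfba, one_mulVec,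
        sub_self, mulVec_zero]
  · rintro ⟨p, hp, hpab⟩ r
    have hr := hdec.proj_mulVec_aeval_mulVec (p.map (algebraMap ℚ ℝ)) r (Pi.single a 1)
    rw [hpab] at hr
    rcases hdec.eval_eq_one_or_neg_one hp r with h | h <;> rw [h] at hr
    · left
      rw [hr, one_smul]
    · right
      rw [hr, neg_one_smul, neg_neg]
end
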